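/- For any two simple first-order terms M and N there exists an anti-unifier: a generalisation A of M and N that is maximal in the order ≤, i.e., B ≤ A for every generalisation B of M and N. Moreover, any two such maximal generalisations are equal up to variable renaming. -/

import Mathlib

/-!
Simple first-order terms over a first-order signature `(F, ar)` (function
symbols `F` with arities `ar`): terms built from function symbols and
variables only, with no `λ` and no `fix`; finitely supported substitutions;
the generalisation order `M ≤ N ⟺ ∃σ, M[σ] = N`.
-/

/-- Simple first-order terms over the signature `(F, ar)`. -/
inductive STm (F : Type) (ar : F → ℕ) : Type
  | var : ℕ → STm F ar
  | app : (f : F) → (Fin (ar f) → STm F ar) → STm F ar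

namespace STm

variable {F : Type} {ar : F → ℕ}

/-- Apply a substitution (a map from variables to terms), homomorphically. -/
def subst (σ : ℕ → STm F ar) : STm F ar → STm F ar
  | var x => σ x
  | app f ts => app f fun i => subst σ (ts i)

/-- A substitution is finitely supported. -/
def FinSupp (σ : ℕ → STm F ar) : Prop := {x : ℕ | σ x ≠ var x}.Finite

/-- The generalisation order: `M ≤ N` iff some (finitely supported)
substitution `σ` satisfies `M[σ] = N`. -/
def Le (M N : STm F ar) : Prop := ∃ σ : ℕ → STm F ar, FinSupp σ ∧ subst σ M = N

/-- `A` is a generalisation of `M` and `N` if `A ≤ M` and `A ≤ N`. -/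
def IsGen (A M N : STm F ar) : Prop := Le A M ∧ Le A N

end STm

/-- `A` is an anti-unifier (least general, i.e. maximal, generalisation) of
`M` and `N`. -/
def STm.IsAntiUnifier {F : Type} {ar : F → ℕ} (A M N : STm F ar) : Prop :=
  STm.IsGen A M N ∧ ∀ B : STm F ar, STm.IsGen B M N → STm.Le B A

namespace STm

variable {F : Type} {ar : F → ℕ}

/-- The variables occurring in a term. -/
def vars : STm F ar → Set ℕ
  | var x => {x}
  | app _ ts => ⋃ i, vars (ts i)

theorem vars_finite (M : STm F ar) : M.vars.Finite := by
  induction M with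
  | var x => exact Set.finite_singleton x
  | app f ts ih => exact Set.finite_iUnion ih

theorem subst_congr {σ τ : ℕ → STm F ar} (M : STm F ar) (h : ∀ x ∈ M.vars, σ x = τ x) :
    subst σ M = subst τ M := by
  induction M with
  | var x => exact h x rfl
  | app f ts ih =>
    simp only [subst]
    congr 1
    funext i
    exact ih i fun x hx => h x (Set.mem_iUnion.2 ⟨i, hx⟩)

theorem subst_subst (σ τ : ℕ → STm F ar) (M : STm F ar) :
    subst τ (subst σ M) = subst (fun x => subst τ (σ x)) M := by
  induction M with
  | var x => rfl
  | app f ts ih => simp only [subst, ih]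

/-- A substitution fixing a term fixes all of its variables. -/
theorem eq_var_of_subst_eq_self {σ : ℕ → STm F ar} (M : STm F ar) (h : subst σ M = M) :
    ∀ x ∈ M.vars, σ x = var x := by
  induction M with
  | var y =>
    rintro x rfl
    exact h
  | app f ts ih =>
    intro x hx
    obtain ⟨i, hi⟩ := Set.mem_iUnion.1 hx
    simp only [subst, app.injEq, heq_eq_eq, true_and] at h
    exact ih i (congrFun h i) x hi

open Classical in
/-- Every substitution instance is one by a finitely supported substitution. -/
theorem Le.of_subst_eq {σ : ℕ → STm F ar} {M N : STm F ar} (h : subst σ M = N) : Le M N := by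
  refine ⟨fun x => if x ∈ M.vars then σ x else var x, ?_, ?_⟩
  · refine M.vars_finite.subset fun x hx => ?_
    by_contra hxM
    exact hx (if_neg hxM)
  · rw [← h]
    exact subst_congr M fun x hx => if_pos hx

/-- Terms that are substitution instances of each other differ by a renaming of variables. -/
theorem Le.exists_renaming {A B : STm F ar} (hAB : Le A B) (hBA : Le B A) :
    ∃ ρ : ℕ → ℕ, Function.Bijective ρ ∧ subst (fun x => var (ρ x)) A = B := by
  obtain ⟨σ, -, rfl⟩ := hAB
  obtain ⟨τ, -, hτ⟩ := hBA
  rw [subst_subst] at hτ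
  have hfix := eq_var_of_subst_eq_self A hτ
  have hvar (x : A.vars) : ∃ y, σ x = var y := by
    have hx := hfix x x.2
    cases hσ : σ x with
    | var y => exact ⟨y, rfl⟩
    | app f ts => simp [hσ, subst] at hx
  choose r hr using hvar
  have hinj : Function.Injective r := by
    intro x y hxy
    have hσ : σ x = σ y := by rw [hr, hr, hxy]
    have hx := hfix x x.2
    rw [hσ, hfix y y.2] at hx
    exact Subtype.ext (var.inj hx).symm
  have hfin : Cardinal.mk A.vars < Cardinal.mk ℕ := by
    rw [Cardinal.mk_nat]
    exact A.vars_finite.lt_aleph0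
  obtain ⟨g, hg⟩ := Cardinal.extend_function_of_lt ⟨r, hinj⟩ hfin ⟨Equiv.refl ℕ⟩
  refine ⟨g, g.bijective, subst_congr A fun x hx => ?_⟩
  rw [hr ⟨x, hx⟩]
  exact congrArg var (hg ⟨x, hx⟩)

/-- The set of subterms of a term. -/
def subterms : STm F ar → Set (STm F ar)
  | var x => {var x}
  | app f ts => insert (app f ts) (⋃ i, subterms (ts i))

theorem self_mem_subterms (M : STm F ar) : M ∈ M.subterms := by
  cases M with
  | var x => exact rfl
  | app f ts => exact Set.mem_insert _ _

theorem subterms_arg_subset (f : F) (ts : Fin (ar f) → STm F ar) (i : Fin (ar f)) :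
    (ts i).subterms ⊆ (app f ts).subterms :=
  (Set.subset_iUnion (fun j => (ts j).subterms) i).trans (Set.subset_insert _ _)

theorem subterms_countable (M : STm F ar) : M.subterms.Countable := by
  induction M with
  | var x => exact Set.countable_singleton _
  | app f ts ih => exact (Set.countable_iUnion ih).insert _

open Classical in
/-- Plotkin's anti-unification: descend while the head symbols agree, and replace a pair of
disagreeing subterms by the variable that `φ` assigns to it. -/
noncomputable def antiUnify (φ : STm F ar × STm F ar → ℕ) : STm F ar → STm F ar → STm F ar
  | var x, N => var (φ (var x, N))
  | app f ts, var y => var (φ (app f ts, var y))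
  | app f ts, app g us =>
    if h : f = g then app f fun i => antiUnify φ (ts i) (us (Fin.cast (congrArg ar h) i))
    else var (φ (app f ts, app g us))

theorem antiUnify_app (φ : STm F ar × STm F ar → ℕ) (f : F) (ts us : Fin (ar f) → STm F ar) :
    antiUnify φ (app f ts) (app f us) = app f fun i => antiUnify φ (ts i) (us i) := by
  simp [antiUnify]

theorem subst_antiUnify_subst (φ : STm F ar × STm F ar → ℕ) (σ τ : ℕ → STm F ar)
    (B : STm F ar) :
    subst (fun x => antiUnify φ (σ x) (τ x)) B = antiUnify φ (subst σ B) (subst τ B) := by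
  induction B with
  | var x => rfl
  | app f ts ih => simp only [subst, antiUnify_app, ih]

/-- Substituting back the pair named by each variable recovers both terms. -/
theorem subst_antiUnify {φ : STm F ar × STm F ar → ℕ} {θ₁ θ₂ : ℕ → STm F ar} (M N : STm F ar)
    (h : ∀ s ∈ M.subterms, ∀ t ∈ N.subterms, θ₁ (φ (s, t)) = s ∧ θ₂ (φ (s, t)) = t) :
    subst θ₁ (antiUnify φ M N) = M ∧ subst θ₂ (antiUnify φ M N) = N := by
  have hMN := h M M.self_mem_subterms N N.self_mem_subterms
  induction M generalizing N with
  | var x => simpa only [antiUnify, subst] using hMN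
  | app f ts ih =>
    cases N with
    | var y => simpa only [antiUnify, subst] using hMN
    | app g us =>
      by_cases hfg : f = g
      · subst hfg
        have hargs (i : Fin (ar f)) := ih i (us i)
          (fun s hs t ht =>
            h s (subterms_arg_subset f ts i hs) t (subterms_arg_subset f us i ht))
          (h _ (subterms_arg_subset f ts i (self_mem_subterms _)) _
            (subterms_arg_subset f us i (self_mem_subterms _)))
        rw [antiUnify_app]
        exact ⟨congrArg (app f) (funext fun i => (hargs i).1),
          congrArg (app f) (funext fun i => (hargs i).2)⟩
      · simpa only [antiUnify, dif_neg hfg, subst] using hMN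

theorem exists_isAntiUnifier (M N : STm F ar) : ∃ A : STm F ar, IsAntiUnifier A M N := by
  obtain ⟨φ, hφ⟩ := Set.countable_iff_exists_injOn.1
    (M.subterms_countable.prod N.subterms_countable)
  have : Nonempty (STm F ar × STm F ar) := ⟨(M, N)⟩
  have hinv := hφ.leftInvOn_invFunOn
  obtain ⟨hM, hN⟩ := subst_antiUnify (φ := φ)
    (θ₁ := fun n => (Function.invFunOn φ (M.subterms ×ˢ N.subterms) n).1)
    (θ₂ := fun n => (Function.invFunOn φ (M.subterms ×ˢ N.subterms) n).2) M N
    (fun s hs t ht => Prod.ext_iff.1 (hinv (Set.mk_mem_prod hs ht)))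
  refine ⟨antiUnify φ M N, ⟨Le.of_subst_eq hM, Le.of_subst_eq hN⟩, ?_⟩
  rintro B ⟨⟨σ, -, rfl⟩, ⟨τ, -, rfl⟩⟩
  exact Le.of_subst_eq (subst_antiUnify_subst φ σ τ B)

end STm

/-- Any two simple first-order terms `M` and `N` have an anti-unifier: a
generalisation `A` of `M` and `N` that is maximal in the order `≤`, i.e. every
generalisation `B` of `M` and `N` satisfies `B ≤ A`.  Moreover any two such
maximal generalisations are equal up to variable renaming. -/
theorem anti_unifier_exists_unique {F : Type} {ar : F → ℕ} (M N : STm F ar) :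
    (∃ A : STm F ar, STm.IsAntiUnifier A M N) ∧
    ∀ A A' : STm F ar, STm.IsAntiUnifier A M N → STm.IsAntiUnifier A' M N →
      ∃ ρ : ℕ → ℕ, Function.Bijective ρ ∧
        STm.subst (fun x => STm.var (ρ x)) A = A' := by
  exact ⟨STm.exists_isAntiUnifier M N, fun A A' hA hA' =>
    STm.Le.exists_renaming (hA'.2 A hA.1) (hA.2 A' hA'.1)⟩
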